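/- Let 1 < p < ∞ and m ≥ 1. There exists a constant ζ > 0, depending only on m and p, such that for all real scalars (a_i)_{i=0}^m and every 0 ≤ i_0 < m, every minimizer t_0 of the function t ↦ ‖Σ_{i=0}^{i_0−1} a_i h_i^{(p)} + t·h_{i_0}^{(p)} + Σ_{i=i_0+1}^m a_i h_i^{(p)}‖_{L_p[0,1]} satisfies |t_0| ≤ ζ·Σ_{i=i_0+1}^m |a_i|. That is, the initial segment (h_i^{(p)})_{i=0}^m of the Haar basis has Property P with some constant ζ(m,p). -/

import Mathlib

open MeasureTheory

/-- The Haar functions on `[0,1]` (extended by `0` to all of `ℝ`): `haarFn 0` is the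
indicator of `[0,1)` (i.e. `h₀ ≡ 1` on `[0,1]` up to the single point `1`), and for
`i = 2^n + k` with `0 ≤ k < 2^n` (so that `n = Nat.log 2 i`), `haarFn i` is `1` on
`[k/2^n, (2k+1)/2^(n+1))`, `-1` on `[(2k+1)/2^(n+1), (k+1)/2^n)` and `0` elsewhere. -/
noncomputable def haarFn (i : ℕ) : ℝ → ℝ :=
  if i = 0 then Set.indicator (Set.Ico (0 : ℝ) 1) 1
  else
    let n := Nat.log 2 i
    let k := i - 2 ^ n
    fun t =>
      Set.indicator (Set.Ico ((k : ℝ) / 2 ^ n) ((2 * (k : ℝ) + 1) / 2 ^ (n + 1))) 1 t -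
        Set.indicator (Set.Ico ((2 * (k : ℝ) + 1) / 2 ^ (n + 1)) (((k : ℝ) + 1) / 2 ^ n)) 1 t

/-- The `L_p[0,1]` norm of a function `f : ℝ → ℝ`. -/
noncomputable def pnorm (p : ℝ) (f : ℝ → ℝ) : ℝ :=
  (eLpNorm f (ENNReal.ofReal p) (volume.restrict (Set.Ico (0 : ℝ) 1))).toReal

/-- The `L_p`-normalized Haar function `h_i^{(p)} = h_i / ‖h_i‖_p`. -/
noncomputable def haarFnP (p : ℝ) (i : ℕ) : ℝ → ℝ :=
  fun t => haarFn i t / pnorm p (haarFn i)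

/-- The norming functional of a nonzero `y ∈ L_p[0,1]` applied to `g`:
`F_y(g) = ‖y‖_p^{1−p} ∫₀¹ sign(y(t)) |y(t)|^{p−1} g(t) dt`. -/
noncomputable def normingF (p : ℝ) (y g : ℝ → ℝ) : ℝ :=
  pnorm p y ^ (1 - p) *
    ∫ t in Set.Ico (0 : ℝ) 1, Real.sign (y t) * |y t| ^ (p - 1) * g t

section HaarFunctions

lemma haarFn_zero : haarFn 0 = Set.indicator (Set.Ico (0 : ℝ) 1) 1 := by
  simp [haarFn]

/-- Explicit form of a Haar function of positive index. -/
lemma haarFn_two_pow_add {n k : ℕ} (hk : k < 2 ^ n) (t : ℝ) :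
    haarFn (2 ^ n + k) t =
      Set.indicator (Set.Ico ((k : ℝ) / 2 ^ n) ((2 * (k : ℝ) + 1) / 2 ^ (n + 1))) 1 t -
        Set.indicator (Set.Ico ((2 * (k : ℝ) + 1) / 2 ^ (n + 1)) (((k : ℝ) + 1) / 2 ^ n)) 1 t := by
  have hlog : Nat.log 2 (2 ^ n + k) = n :=
    Nat.log_eq_of_pow_le_of_lt_pow (by omega) (by rw [pow_succ]; omega)
  have hpos : 2 ^ n + k ≠ 0 := by positivity
  simp only [haarFn, if_neg hpos, hlog, Nat.add_sub_cancel_left]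

lemma exists_eq_two_pow_add {i : ℕ} (hi : i ≠ 0) : ∃ n k, k < 2 ^ n ∧ i = 2 ^ n + k := by
  have h1 := Nat.pow_log_le_self 2 hi
  have h2 := Nat.lt_pow_succ_log_self one_lt_two i
  refine ⟨Nat.log 2 i, i - 2 ^ Nat.log 2 i, ?_, by omega⟩
  rw [pow_succ] at h2
  omega

lemma dyadic_midpoint_bounds (n k : ℕ) :
    (k : ℝ) / 2 ^ n < (2 * (k : ℝ) + 1) / 2 ^ (n + 1) ∧
      (2 * (k : ℝ) + 1) / 2 ^ (n + 1) < ((k : ℝ) + 1) / 2 ^ n := by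
  have h : (0 : ℝ) < 2 ^ n := by positivity
  constructor <;> rw [div_lt_div_iff₀ (by positivity) (by positivity), pow_succ] <;> nlinarith

lemma dyadic_Ico_subset {n k : ℕ} (hk : k < 2 ^ n) :
    Set.Ico ((k : ℝ) / 2 ^ n) (((k : ℝ) + 1) / 2 ^ n) ⊆ Set.Ico 0 1 := by
  have h : (k : ℝ) + 1 ≤ 2 ^ n := by exact_mod_cast hk
  exact Set.Ico_subset_Ico (by positivity) ((div_le_one (by positivity)).2 h)

/-- A Haar function of positive index vanishes exactly off its dyadic interval. -/
lemma haarFn_ne_zero_iff {n k : ℕ} (hk : k < 2 ^ n) (t : ℝ) :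
    haarFn (2 ^ n + k) t ≠ 0 ↔ t ∈ Set.Ico ((k : ℝ) / 2 ^ n) (((k : ℝ) + 1) / 2 ^ n) := by
  obtain ⟨h1, h2⟩ := dyadic_midpoint_bounds n k
  rw [haarFn_two_pow_add hk]
  simp only [Set.indicator_apply, Set.mem_Ico, Pi.one_apply]
  split_ifs <;> grind

lemma haarFn_values (i : ℕ) (t : ℝ) : haarFn i t = 0 ∨ haarFn i t = 1 ∨ haarFn i t = -1 := by
  rcases eq_or_ne i 0 with rfl | hi
  · rw [haarFn_zero, Set.indicator_apply]
    split_ifs <;> simp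
  · obtain ⟨n, k, hk, rfl⟩ := exists_eq_two_pow_add hi
    rw [haarFn_two_pow_add hk]
    simp only [Set.indicator_apply, Set.mem_Ico, Pi.one_apply]
    split_ifs <;> grind

lemma abs_haarFn_le_one (i : ℕ) (t : ℝ) : |haarFn i t| ≤ 1 := by
  rcases haarFn_values i t with h | h | h <;> simp [h]

lemma abs_haarFn_eq_one {i : ℕ} {t : ℝ} (h : haarFn i t ≠ 0) : |haarFn i t| = 1 := by
  rcases haarFn_values i t with h' | h' | h' <;> simp_all

lemma measurable_haarFn (i : ℕ) : Measurable (haarFn i) := by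
  rcases eq_or_ne i 0 with rfl | hi
  · rw [haarFn_zero]
    exact measurable_one.indicator measurableSet_Ico
  · obtain ⟨n, k, hk, rfl⟩ := exists_eq_two_pow_add hi
    rw [funext (haarFn_two_pow_add hk)]
    exact (measurable_one.indicator measurableSet_Ico).sub
      (measurable_one.indicator measurableSet_Ico)

/-- The support of every Haar function has positive measure in the unit interval. -/
lemma measure_support_haarFn_pos (i : ℕ) :
    0 < (volume.restrict (Set.Ico (0 : ℝ) 1)) {t | haarFn i t ≠ 0} := by
  have hmeas : MeasurableSet {t | haarFn i t ≠ 0} :=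
    (measurable_haarFn i (measurableSet_singleton 0)).compl
  rw [Measure.restrict_apply hmeas]
  rcases eq_or_ne i 0 with rfl | hi
  · have : {t | haarFn 0 t ≠ 0} ∩ Set.Ico (0 : ℝ) 1 = Set.Ico 0 1 := by
      ext t
      simp [haarFn_zero]
    simp [this]
  · obtain ⟨n, k, hk, rfl⟩ := exists_eq_two_pow_add hi
    have : {t | haarFn (2 ^ n + k) t ≠ 0} ∩ Set.Ico (0 : ℝ) 1 =
        Set.Ico ((k : ℝ) / 2 ^ n) (((k : ℝ) + 1) / 2 ^ n) := by
      simp only [haarFn_ne_zero_iff hk, Set.ofPred_mem_eq]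
      exact Set.inter_eq_left.2 (dyadic_Ico_subset hk)
    obtain ⟨h1, h2⟩ := dyadic_midpoint_bounds n k
    rw [this, Real.volume_Ico, ENNReal.ofReal_pos]
    linarith

lemma setIntegral_indicator_Ico_one {a b : ℝ} (ha : 0 ≤ a) (hab : a ≤ b) (hb : b ≤ 1) :
    ∫ t in Set.Ico (0 : ℝ) 1, Set.indicator (Set.Ico a b) (1 : ℝ → ℝ) t = b - a := by
  rw [setIntegral_indicator measurableSet_Ico,
    Set.inter_eq_right.2 (Set.Ico_subset_Ico ha hb)]
  simp [hab]

lemma integrable_indicator_Ico_one (a b : ℝ) :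
    Integrable (Set.indicator (Set.Ico a b) (1 : ℝ → ℝ))
      (volume.restrict (Set.Ico (0 : ℝ) 1)) :=
  (integrable_const (1 : ℝ)).indicator measurableSet_Ico

lemma setIntegral_haarFn_eq_zero {i : ℕ} (hi : i ≠ 0) :
    ∫ t in Set.Ico (0 : ℝ) 1, haarFn i t = 0 := by
  obtain ⟨n, k, hk, rfl⟩ := exists_eq_two_pow_add hi
  obtain ⟨h1, h2⟩ := dyadic_midpoint_bounds n k
  have h3 : (k : ℝ) + 1 ≤ 2 ^ n := by exact_mod_cast hk
  have h4 : ((k : ℝ) + 1) / 2 ^ n ≤ 1 := (div_le_one (by positivity)).2 h3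
  have h5 : 0 ≤ (k : ℝ) / 2 ^ n := by positivity
  simp only [haarFn_two_pow_add hk]
  rw [integral_sub (integrable_indicator_Ico_one _ _) (integrable_indicator_Ico_one _ _),
    setIntegral_indicator_Ico_one h5 h1.le (h2.le.trans h4),
    setIntegral_indicator_Ico_one (h5.trans h1.le) h2.le h4]
  field_simp
  ring

/-- Comparing a point of a dyadic interval with a coarser dyadic number. -/
lemma dyadic_le_iff {n N k : ℕ} (hN : N ≤ n) {t : ℝ}
    (ht : t ∈ Set.Ico ((k : ℝ) / 2 ^ n) (((k : ℝ) + 1) / 2 ^ n)) (A : ℕ) :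
    (A : ℝ) / 2 ^ N ≤ t ↔ A * 2 ^ (n - N) ≤ k := by
  have hA : (A : ℝ) / 2 ^ N = ((A * 2 ^ (n - N) : ℕ) : ℝ) / 2 ^ n := by
    have : (2 : ℝ) ^ n = 2 ^ N * 2 ^ (n - N) := by rw [← pow_add, Nat.add_sub_cancel' hN]
    push_cast
    rw [this]
    field_simp
  have hpos : (0 : ℝ) < 2 ^ n := by positivity
  rw [hA]
  constructor
  · intro h
    have h' := (div_lt_div_iff_of_pos_right hpos).1 (h.trans_lt ht.2)
    exact Nat.lt_succ_iff.1 (by exact_mod_cast h')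
  · intro h
    refine le_trans ?_ ht.1
    gcongr

/-- A Haar function is constant on the support of every later Haar function. -/
lemma haarFn_eq_of_lt {i j : ℕ} (hji : j < i) {x y : ℝ} (hx : haarFn i x ≠ 0)
    (hy : haarFn i y ≠ 0) : haarFn j x = haarFn j y := by
  obtain ⟨n, k, hk, rfl⟩ := exists_eq_two_pow_add (Nat.ne_zero_of_lt hji)
  rw [haarFn_ne_zero_iff hk] at hx hy
  rcases eq_or_ne j 0 with rfl | hj
  · simp [haarFn_zero, dyadic_Ico_subset hk hx, dyadic_Ico_subset hk hy]
  obtain ⟨N, l, hl, rfl⟩ := exists_eq_two_pow_add hj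
  have hNn : N ≤ n := by
    by_contra! h
    have := Nat.pow_le_pow_right two_pos (Nat.succ_le_of_lt h)
    rw [Nat.succ_eq_add_one, pow_succ] at this
    omega
  rcases hNn.eq_or_lt with rfl | hlt
  · have key : ∀ t ∈ Set.Ico ((k : ℝ) / 2 ^ N) (((k : ℝ) + 1) / 2 ^ N),
        haarFn (2 ^ N + l) t = 0 := by
      intro t ht
      by_contra hne
      have ht' := (haarFn_ne_zero_iff hl t).1 hne
      have h1 := (dyadic_le_iff le_rfl ht' k).1 ht.1
      have : l < k := by omega
      simp at h1
      omega
    rw [key x hx, key y hy]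
  · have key : ∀ t ∈ Set.Ico ((k : ℝ) / 2 ^ n) (((k : ℝ) + 1) / 2 ^ n),
        ((l : ℝ) / 2 ^ N ≤ t ↔ l * 2 ^ (n - N) ≤ k) ∧
        ((2 * (l : ℝ) + 1) / 2 ^ (N + 1) ≤ t ↔ (2 * l + 1) * 2 ^ (n - (N + 1)) ≤ k) ∧
        (((l : ℝ) + 1) / 2 ^ N ≤ t ↔ (l + 1) * 2 ^ (n - N) ≤ k) := by
      intro t ht
      refine ⟨dyadic_le_iff hNn ht l, ?_, ?_⟩
      · exact_mod_cast dyadic_le_iff hlt ht (2 * l + 1)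
      · exact_mod_cast dyadic_le_iff hNn ht (l + 1)
    obtain ⟨x1, x2, x3⟩ := key x hx
    obtain ⟨y1, y2, y3⟩ := key y hy
    simp only [haarFn_two_pow_add hl, Set.indicator_apply, Set.mem_Ico, ← not_le,
      x1, x2, x3, y1, y2, y3, Pi.one_apply]

end HaarFunctions

section AbsRpow

lemma strictConvexOn_abs_rpow {p : ℝ} (hp : 1 < p) :
    StrictConvexOn ℝ Set.univ fun u : ℝ => |u| ^ p := by
  refine ⟨convex_univ, fun x _ y _ hxy a b ha hb hab => ?_⟩
  simp only [smul_eq_mul]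
  have htri : |a * x + b * y| ≤ a * |x| + b * |y| := by
    refine (abs_add_le _ _).trans_eq ?_
    rw [abs_mul, abs_mul, abs_of_pos ha, abs_of_pos hb]
  rcases eq_or_ne |x| |y| with h | h
  · obtain rfl : x = -y := (abs_eq_abs.1 h).resolve_left hxy
    have hy : y ≠ 0 := fun h0 => hxy (by simp [h0])
    have hlt : |a * -y + b * y| < |y| := by
      rw [show a * -y + b * y = (b - a) * y by ring, abs_mul]
      have : |b - a| < 1 := abs_lt.2 ⟨by linarith, by linarith⟩
      have := abs_pos.2 hy
      nlinarith
    rw [abs_neg, ← add_mul, hab, one_mul]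
    exact Real.rpow_lt_rpow (abs_nonneg _) hlt (by linarith)
  · exact (Real.rpow_le_rpow (abs_nonneg _) htri (by linarith)).trans_lt
      ((strictConvexOn_rpow hp).2 (abs_nonneg x) (abs_nonneg y) h ha hb hab)

/-- Moving away from `c` increases a strictly convex function faster than its tangent at `c`. -/
lemma StrictConvexOn.tangent_mul_sub_lt {f : ℝ → ℝ} (hf : StrictConvexOn ℝ Set.univ f)
    {c s u v : ℝ} (hs : HasDerivAt f s c) (h : c ≤ v ∧ v < u ∨ u < v ∧ v ≤ c) :
    s * (u - v) < f u - f v := by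
  rcases h with ⟨hcv, hvu⟩ | ⟨huv, hvc⟩
  · have key : s < (f u - f v) / (u - v) := by
      rcases hcv.eq_or_lt with rfl | hlt
      · simpa [slope_def_field] using hf.lt_slope_of_hasDerivAt trivial trivial hvu hs
      · have h := hf.lt_slope_of_hasDerivAt trivial trivial hlt hs
        rw [slope_def_field] at h
        exact h.trans (hf.slope_strict_mono_adjacent trivial trivial hlt hvu)
    exact (lt_div_iff₀ (sub_pos.2 hvu)).1 key
  · have key : (f v - f u) / (v - u) < s := by
      rcases hvc.eq_or_lt with rfl | hlt
      · simpa [slope_def_field] using hf.slope_lt_of_hasDerivAt trivial trivial huv hs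
      · have h := hf.slope_lt_of_hasDerivAt trivial trivial hlt hs
        rw [slope_def_field] at h
        exact (hf.slope_strict_mono_adjacent trivial trivial huv hlt).trans h
    have := (div_lt_iff₀ (sub_pos.2 huv)).1 key
    linarith

end AbsRpow

section Minimizer

variable {Ω : Type*} [MeasurableSpace Ω] {μ : Measure Ω} [IsFiniteMeasure μ]

lemma integrable_abs_rpow {p : ℝ} (hp : 0 < p) {f : Ω → ℝ}
    (hf : MemLp f (ENNReal.ofReal p) μ) : Integrable (fun x => |f x| ^ p) μ := by
  simpa [ENNReal.toReal_ofReal hp.le] using hf.integrable_norm_rpow'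

/-- A minimizer of the `L_p`-norm of `B + t H + T` over `t` is controlled by `sup |T|`, when `H`
has constant modulus and `B` is constant on the support of `H`. -/
lemma abs_mul_le_of_integral_rpow_minimizer {p : ℝ} (hp : 1 < p) {B H T : Ω → ℝ}
    (hB : MemLp B (ENNReal.ofReal p) μ) (hH : MemLp H (ENNReal.ofReal p) μ)
    (hT : MemLp T (ENNReal.ofReal p) μ) {c α M t₀ : ℝ}
    (habs : ∀ x, H x ≠ 0 → |H x| = α) (hconst : ∀ x, H x ≠ 0 → B x = c)
    (hM : ∀ x, |T x| ≤ M) (hmean : c = 0 ∨ ∫ x, H x ∂μ = 0) (hpos : 0 < μ {x | H x ≠ 0})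
    (hmin : ∀ t, ∫ x, |B x + t₀ * H x + T x| ^ p ∂μ ≤ ∫ x, |B x + t * H x + T x| ^ p ∂μ) :
    |t₀| * α ≤ M := by
  by_contra! hlt
  have hne : {x | H x ≠ 0}.Nonempty := nonempty_of_measure_ne_zero hpos.ne'
  have hM0 : 0 ≤ M := (abs_nonneg _).trans (hM hne.some)
  have hden : 0 < |t₀| * α := hM0.trans_lt hlt
  obtain ⟨r, hr⟩ : ∃ r, r = M / (|t₀| * α) := ⟨_, rfl⟩
  have hr1 : r < 1 := by rwa [hr, div_lt_one hden]
  have hrM : r * (|t₀| * α) = M := by rw [hr, div_mul_cancel₀ _ hden.ne']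
  set s := p * |c| ^ (p - 2) * c with hs
  have hderiv : HasDerivAt (fun u : ℝ => |u| ^ p) s c := hasDerivAt_abs_rpow c hp
  have hsmean : s * ∫ x, H x ∂μ = 0 := by
    rcases hmean with h | h <;> simp [hs, h]
  have hlp : ∀ t : ℝ, Integrable (fun x => |B x + t * H x + T x| ^ p) μ := fun t =>
    integrable_abs_rpow (by linarith) ((hB.add (hH.const_mul t)).add hT)
  have hHint : Integrable H μ :=
    hH.integrable (by rw [← ENNReal.ofReal_one]; exact ENNReal.ofReal_le_ofReal hp.le)
  set D : Ω → ℝ := fun x => |B x + t₀ * H x + T x| ^ p - |B x + (r * t₀) * H x + T x| ^ p -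
    s * (t₀ - r * t₀) * H x with hD
  have hDpos : ∀ x, H x ≠ 0 → 0 < D x := by
    intro x hx
    have h1 : |t₀ * H x| = |t₀| * α := by rw [abs_mul, habs x hx]
    have hT1 := abs_le.1 (hM x)
    have key := (strictConvexOn_abs_rpow hp).tangent_mul_sub_lt (u := B x + t₀ * H x + T x)
      (v := B x + (r * t₀) * H x + T x) hderiv ?_
    · simp only [hD]
      linear_combination key
    · rw [hconst x hx]
      rcases le_or_gt 0 (t₀ * H x) with h | h
      · rw [abs_of_nonneg h] at h1
        left
        constructor <;> nlinarith
      · rw [abs_of_neg h] at h1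
        right
        constructor <;> nlinarith
  have hD0 : 0 ≤ D := by
    intro x
    by_cases hx : H x = 0
    · simp [hD, hx]
    · exact (hDpos x hx).le
  have hDint : Integrable D μ := ((hlp t₀).sub (hlp (r * t₀))).sub (hHint.const_mul _)
  have hI : 0 < ∫ x, D x ∂μ := by
    rw [integral_pos_iff_support_of_nonneg hD0 hDint]
    exact hpos.trans_le (measure_mono fun x hx => (hDpos x hx).ne')
  have hI' : ∫ x, D x ∂μ = ∫ x, |B x + t₀ * H x + T x| ^ p ∂μ -
      ∫ x, |B x + (r * t₀) * H x + T x| ^ p ∂μ := by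
    have hdiff : Integrable
        (fun x => |B x + t₀ * H x + T x| ^ p - |B x + (r * t₀) * H x + T x| ^ p) μ :=
      (hlp t₀).sub (hlp (r * t₀))
    simp only [hD]
    rw [integral_sub hdiff (hHint.const_mul _), integral_sub (hlp t₀) (hlp (r * t₀)), integral_const_mul]
    linear_combination -(t₀ - r * t₀) * hsmean
  linarith [hmin (r * t₀)]

end Minimizer

section UnitInterval

lemma pnorm_eq_integral {p : ℝ} (hp : 0 < p) {f : ℝ → ℝ}
    (hf : MemLp f (ENNReal.ofReal p) (volume.restrict (Set.Ico (0 : ℝ) 1))) :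
    pnorm p f = (∫ t in Set.Ico (0 : ℝ) 1, |f t| ^ p) ^ p⁻¹ := by
  rw [pnorm, hf.eLpNorm_eq_integral_rpow_norm (by simpa using hp) ENNReal.ofReal_ne_top,
    ENNReal.toReal_ofReal (by positivity), ENNReal.toReal_ofReal hp.le]
  simp only [Real.norm_eq_abs]

lemma pnorm_le_pnorm_iff {p : ℝ} (hp : 0 < p) {f g : ℝ → ℝ}
    (hf : MemLp f (ENNReal.ofReal p) (volume.restrict (Set.Ico (0 : ℝ) 1)))
    (hg : MemLp g (ENNReal.ofReal p) (volume.restrict (Set.Ico (0 : ℝ) 1))) :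
    pnorm p f ≤ pnorm p g ↔
      ∫ t in Set.Ico (0 : ℝ) 1, |f t| ^ p ≤ ∫ t in Set.Ico (0 : ℝ) 1, |g t| ^ p := by
  rw [pnorm_eq_integral hp hf, pnorm_eq_integral hp hg]
  exact Real.rpow_le_rpow_iff (integral_nonneg fun _ => by positivity)
    (integral_nonneg fun _ => by positivity) (inv_pos.2 hp)

lemma memLp_haarFn (p : ℝ) (i : ℕ) :
    MemLp (haarFn i) (ENNReal.ofReal p) (volume.restrict (Set.Ico (0 : ℝ) 1)) :=
  MemLp.of_bound (measurable_haarFn i).aestronglyMeasurable 1 (.of_forall (abs_haarFn_le_one i))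

lemma memLp_haarFnP (p : ℝ) (i : ℕ) :
    MemLp (haarFnP p i) (ENNReal.ofReal p) (volume.restrict (Set.Ico (0 : ℝ) 1)) := by
  unfold haarFnP
  simpa only [div_eq_inv_mul] using (memLp_haarFn p i).const_mul (pnorm p (haarFn i))⁻¹

lemma pnorm_haarFn_pos {p : ℝ} (hp : 0 < p) (i : ℕ) : 0 < pnorm p (haarFn i) := by
  rw [pnorm_eq_integral hp (memLp_haarFn p i)]
  refine Real.rpow_pos_of_pos ?_ _
  rw [integral_pos_iff_support_of_nonneg (fun _ => by positivity)
    (integrable_abs_rpow hp (memLp_haarFn p i))]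
  refine (measure_support_haarFn_pos i).trans_le (measure_mono fun t ht => ?_)
  simp [abs_haarFn_eq_one ht]

lemma pnorm_haarFn_le_one {p : ℝ} (hp : 0 < p) (i : ℕ) : pnorm p (haarFn i) ≤ 1 := by
  rw [pnorm_eq_integral hp (memLp_haarFn p i)]
  refine Real.rpow_le_one (integral_nonneg fun _ => by positivity) ?_ (by positivity)
  calc ∫ t in Set.Ico (0 : ℝ) 1, |haarFn i t| ^ p ≤ ∫ _ in Set.Ico (0 : ℝ) 1, (1 : ℝ) :=
        integral_mono (integrable_abs_rpow hp (memLp_haarFn p i)) (integrable_const _)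
          fun t => Real.rpow_le_one (abs_nonneg _) (abs_haarFn_le_one i t) hp.le
    _ = 1 := by simp

lemma memLp_sum_haarFnP (p : ℝ) (a : ℕ → ℝ) (S : Finset ℕ) :
    MemLp (fun s => ∑ i ∈ S, a i * haarFnP p i s) (ENNReal.ofReal p)
      (volume.restrict (Set.Ico (0 : ℝ) 1)) :=
  memLp_finsetSum S fun i _ => (memLp_haarFnP p i).const_mul (a i)

lemma exists_sum_haarFnP_eq (p : ℝ) (a : ℕ → ℝ) (i₀ : ℕ) :
    ∃ c, (∀ x, haarFn i₀ x ≠ 0 → ∑ i ∈ Finset.range i₀, a i * haarFnP p i x = c) ∧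
      (i₀ = 0 → c = 0) := by
  obtain ⟨y, hy⟩ : {t | haarFn i₀ t ≠ 0}.Nonempty :=
    nonempty_of_measure_ne_zero (measure_support_haarFn_pos i₀).ne'
  refine ⟨∑ i ∈ Finset.range i₀, a i * haarFnP p i y, fun x hx => ?_, by rintro rfl; simp⟩
  refine Finset.sum_congr rfl fun i hi => ?_
  rw [haarFnP, haarFnP, haarFn_eq_of_lt (Finset.mem_range.1 hi) hx hy]

end UnitInterval

/-- for `1 < p < ∞` and `m ≥ 1` the initial segment
`(h_i^{(p)})_{i=0}^m` of the Haar basis of `L_p[0,1]` has Property P with a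
constant `ζ = ζ(m,p) > 0`: every minimizer `t₀` of
`t ↦ ‖Σ_{i<i₀} a_i h_i^{(p)} + t h_{i₀}^{(p)} + Σ_{i=i₀+1}^m a_i h_i^{(p)}‖_p`
satisfies `|t₀| ≤ ζ·Σ_{i=i₀+1}^m |a_i|`. -/
theorem stmt_11 (p : ℝ) (hp : 1 < p) (m : ℕ) (hm : 1 ≤ m) :
    ∃ ζ : ℝ, 0 < ζ ∧
      ∀ (a : ℕ → ℝ) (i₀ : ℕ), i₀ < m → ∀ t₀ : ℝ,
        (∀ t : ℝ,
          pnorm p (fun s => (∑ i ∈ Finset.range i₀, a i * haarFnP p i s) +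
              t₀ * haarFnP p i₀ s + ∑ i ∈ Finset.Icc (i₀ + 1) m, a i * haarFnP p i s) ≤
            pnorm p (fun s => (∑ i ∈ Finset.range i₀, a i * haarFnP p i s) +
              t * haarFnP p i₀ s + ∑ i ∈ Finset.Icc (i₀ + 1) m, a i * haarFnP p i s)) →
        |t₀| ≤ ζ * ∑ i ∈ Finset.Icc (i₀ + 1) m, |a i| := by
  have hp0 : 0 < p := by linarith
  have hN := pnorm_haarFn_pos hp0
  have hsum : 0 ≤ ∑ i ∈ Finset.Icc 0 m, (pnorm p (haarFn i))⁻¹ :=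
    Finset.sum_nonneg fun i _ => (inv_pos.2 (hN i)).le
  refine ⟨1 + ∑ i ∈ Finset.Icc 0 m, (pnorm p (haarFn i))⁻¹, by linarith, ?_⟩
  intro a i₀ hi₀ t₀ hmin
  set ζ := 1 + ∑ i ∈ Finset.Icc 0 m, (pnorm p (haarFn i))⁻¹ with hζ
  obtain ⟨c, hc, hc0⟩ := exists_sum_haarFnP_eq p a i₀
  have hne : ∀ x, haarFnP p i₀ x ≠ 0 ↔ haarFn i₀ x ≠ 0 := fun x => by
    simp [haarFnP, (hN i₀).ne']
  have hT : ∀ x, |∑ i ∈ Finset.Icc (i₀ + 1) m, a i * haarFnP p i x| ≤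
      ζ * ∑ i ∈ Finset.Icc (i₀ + 1) m, |a i| := by
    intro x
    rw [Finset.mul_sum]
    refine (Finset.abs_sum_le_sum_abs _ _).trans (Finset.sum_le_sum fun i hi => ?_)
    have h1 : (pnorm p (haarFn i))⁻¹ ≤ ∑ j ∈ Finset.Icc 0 m, (pnorm p (haarFn j))⁻¹ :=
      Finset.single_le_sum (f := fun j => (pnorm p (haarFn j))⁻¹)
        (fun j _ => (inv_pos.2 (hN j)).le) (by simp at hi ⊢; omega)
    have h2 : |haarFnP p i x| ≤ ζ := by
      rw [haarFnP, abs_div, abs_of_pos (hN i), div_eq_mul_inv]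
      have := mul_le_mul_of_nonneg_right (abs_haarFn_le_one i x) (inv_pos.2 (hN i)).le
      linarith
    rw [abs_mul, mul_comm]
    exact mul_le_mul_of_nonneg_right h2 (abs_nonneg _)
  have hlp : ∀ t : ℝ, MemLp (fun s => (∑ i ∈ Finset.range i₀, a i * haarFnP p i s) +
      t * haarFnP p i₀ s + ∑ i ∈ Finset.Icc (i₀ + 1) m, a i * haarFnP p i s)
      (ENNReal.ofReal p) (volume.restrict (Set.Ico (0 : ℝ) 1)) := fun t =>
    ((memLp_sum_haarFnP p a _).add ((memLp_haarFnP p i₀).const_mul t)).add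
      (memLp_sum_haarFnP p a _)
  have key := abs_mul_le_of_integral_rpow_minimizer hp (memLp_sum_haarFnP p a (Finset.range i₀))
    (memLp_haarFnP p i₀) (memLp_sum_haarFnP p a (Finset.Icc (i₀ + 1) m)) (t₀ := t₀)
    (α := (pnorm p (haarFn i₀))⁻¹) (fun x hx => ?_) (fun x hx => hc x ((hne x).1 hx)) hT ?_ ?_
    (fun t => (pnorm_le_pnorm_iff hp0 (hlp t₀) (hlp t)).1 (hmin t))
  · refine (le_mul_of_one_le_right (abs_nonneg t₀) ?_).trans key
    exact (one_le_inv₀ (hN i₀)).2 (pnorm_haarFn_le_one hp0 i₀)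
  · rw [haarFnP, abs_div, abs_of_pos (hN i₀), abs_haarFn_eq_one ((hne x).1 hx), one_div]
  · rcases eq_or_ne i₀ 0 with h | h
    · exact .inl (hc0 h)
    · right
      simp only [haarFnP, integral_div, setIntegral_haarFn_eq_zero h, zero_div]
  · simpa only [hne] using measure_support_haarFn_pos i₀
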